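/- Let S = ⋃ᵢ Dᵢ be a countable union of Gδ subsets of W = (X×Y)ᴺ (i.e., S is Gδσ). Then the Blackwell game Γ(S) is determined: sup_σ inf_τ μ_{σ,τ}(S) = inf_τ sup_σ μ_{σ,τ}(S). -/

import Mathlib

open MeasureTheory Filter

abbrev Play (Z : Type) : Type := ℕ → Z

abbrev Strategy (Z M : Type) : Type := List Z → PMF M

noncomputable def cylProb {X Y : Type} (σ : Strategy (X × Y) X)
    (τ : Strategy (X × Y) Y) (p : List (X × Y)) : ENNReal :=
  ∏ i : Fin p.length,
    σ (p.take i.1) (p.get i).1 * τ (p.take i.1) (p.get i).2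

def cyl {Z : Type} (p : List Z) : Set (Play Z) :=
  {w | ∀ i : Fin p.length, w i.1 = p.get i}

def IsInduced {X Y : Type} [MeasurableSpace X] [MeasurableSpace Y]
    (σ : Strategy (X × Y) X) (τ : Strategy (X × Y) Y)
    (μ : Measure (Play (X × Y))) : Prop :=
  IsProbabilityMeasure μ ∧ ∀ p : List (X × Y), μ (cyl p) = cylProb σ τ p


namespace BW

set_option linter.all false

/-- prefix of a play -/
def pre {Z : Type} (w : Play Z) (n : ℕ) : List Z := List.ofFn (fun i : Fin n => w i)

/-- prepend a position to a play -/
def app {Z : Type} (p : List Z) (w : Play Z) : Play Z :=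
  fun i => if h : i < p.length then p[i] else w (i - p.length)

/-- shifted strategy -/
def sh {Z M : Type} (σ : Strategy Z M) (p : List Z) : Strategy Z M := fun q => σ (p ++ q)

section comb
variable {Z : Type}

@[simp] lemma pre_length (w : Play Z) (n : ℕ) : (pre w n).length = n := by simp [pre]

lemma pre_getElem (w : Play Z) (n i : ℕ) (h : i < (pre w n).length) : (pre w n)[i] = w i := by
  simp [pre]

lemma pre_take (w : Play Z) (n k : ℕ) (h : k ≤ n) : (pre w n).take k = pre w k := by
  apply List.ext_getElem
  · simp [h]
  · intro i h1 h2
    simp [pre_getElem]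

lemma mem_cyl {w : Play Z} {p : List Z} : w ∈ cyl p ↔ pre w p.length = p := by
  constructor
  · intro h
    apply List.ext_getElem
    · simp
    · intro i h1 h2
      rw [pre_getElem]
      exact h ⟨i, h2⟩
  · intro h i
    have := pre_getElem w p.length i.1 (by simp)
    rw [← this]
    simp [h]

lemma mem_cyl_pre (w : Play Z) (n : ℕ) : w ∈ cyl (pre w n) := by
  rw [mem_cyl]; simp

lemma pre_prefix (w : Play Z) {n m : ℕ} (h : n ≤ m) : pre w n <+: pre w m := by
  rw [← pre_take w m n h]; exact List.take_prefix _ _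

lemma cyl_anti {p q : List Z} (h : p <+: q) : cyl q ⊆ cyl p := by
  intro w hw
  rw [mem_cyl] at *
  obtain ⟨r, rfl⟩ := h
  rw [← pre_take w (p ++ r).length p.length (by simp), hw]
  simp

lemma prefix_total {w : Play Z} {p q : List Z} (hp : w ∈ cyl p) (hq : w ∈ cyl q) :
    p <+: q ∨ q <+: p := by
  rw [mem_cyl] at *
  rcases le_total p.length q.length with h | h
  · left; rw [← hp, ← hq]; exact pre_prefix w h
  · right; rw [← hp, ← hq]; exact pre_prefix w h

lemma pre_app_le (p : List Z) (w : Play Z) (n : ℕ) (h : n ≤ p.length) :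
    pre (app p w) n = p.take n := by
  apply List.ext_getElem
  · simp [h]
  · intro i h1 h2
    have : i < p.length := by simp at h1; omega
    simp [pre_getElem, app, this]

lemma pre_app_add (p : List Z) (w : Play Z) (n : ℕ) :
    pre (app p w) (p.length + n) = p ++ pre w n := by
  apply List.ext_getElem
  · simp
  · intro i h1 h2
    rw [pre_getElem, List.getElem_append]
    by_cases h : i < p.length
    · simp [app, h]
    · simp [app, h, pre_getElem]

lemma app_mem_cyl (p : List Z) (w : Play Z) : app p w ∈ cyl p := by
  rw [mem_cyl, pre_app_le _ _ _ le_rfl]; simp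

lemma app_mem_cyl_append (p r : List Z) (w : Play Z) : app p w ∈ cyl (p ++ r) ↔ w ∈ cyl r := by
  rw [mem_cyl, mem_cyl, List.length_append, pre_app_add]; simp

lemma app_append (p r : List Z) (w : Play Z) : app (p ++ r) w = app p (app r w) := by
  funext i
  simp only [app, List.length_append, List.getElem_append]
  by_cases h : i < p.length
  · simp [h, Nat.lt_add_right]
  · by_cases h2 : i - p.length < r.length
    · have : i < p.length + r.length := by omega
      simp [h, h2, this]
    · have : ¬ i < p.length + r.length := by omega
      simp [h, h2, this, Nat.sub_sub]

lemma app_nil (w : Play Z) : app [] w = w := by funext i; simp [app]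

lemma sh_nil {M : Type} (σ : Strategy Z M) : sh σ [] = σ := rfl

lemma sh_append {M : Type} (σ : Strategy Z M) (p q : List Z) :
    sh σ (p ++ q) = sh (sh σ p) q := by
  funext r; simp [sh]

/-- tail of a play -/
def tl (n : ℕ) (w : Play Z) : Play Z := fun i => w (n + i)

lemma tl_app (p : List Z) (w : Play Z) : tl p.length (app p w) = w := by
  funext i; simp [tl, app]

lemma app_tl {p : List Z} {w : Play Z} (h : w ∈ cyl p) : app p (tl p.length w) = w := by
  funext i
  simp only [app, tl]
  split_ifs with hi
  · exact (h ⟨i, hi⟩).symm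
  · congr 1; omega

lemma cyl_nil : (cyl ([] : List Z)) = Set.univ := by
  ext w; simp [mem_cyl, pre]

/-- minimal positions -/
def mn (H : List Z → Prop) : Set (List Z) := {a | H a ∧ ∀ k < a.length, ¬ H (a.take k)}

/-- plays never meeting H -/
def noHit (H : List Z → Prop) : Set (Play Z) := {w | ∀ k, ¬ H (pre w k)}

lemma mn_prefix {H : List Z → Prop} {a b : List Z} (ha : a ∈ mn H) (hb : b ∈ mn H)
    (h : a <+: b) : a = b := by
  by_contra hne
  have hl : a.length < b.length := by
    rcases h.length_le.lt_or_eq with h1 | h1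
    · exact h1
    · exact absurd (h.eq_of_length h1) hne
  apply hb.2 _ hl
  obtain ⟨r, rfl⟩ := h
  simpa using ha.1

lemma mn_disj {H : List Z → Prop} {a b : List Z} (ha : a ∈ mn H) (hb : b ∈ mn H)
    {w : Play Z} (hwa : w ∈ cyl a) (hwb : w ∈ cyl b) : a = b := by
  rcases prefix_total hwa hwb with h | h
  · exact mn_prefix ha hb h
  · exact (mn_prefix hb ha h).symm

lemma exists_mn {H : List Z → Prop} {w : Play Z} (hw : w ∉ noHit H) :
    ∃ a ∈ mn H, w ∈ cyl a := by
  classical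
  simp only [noHit, Set.mem_ofPred_eq, not_forall, not_not] at hw
  refine ⟨pre w (Nat.find hw), ⟨Nat.find_spec hw, ?_⟩, mem_cyl_pre _ _⟩
  intro k hk
  rw [pre_length] at hk
  rw [pre_take _ _ _ hk.le]
  exact Nat.find_min hw hk

lemma not_noHit {H : List Z → Prop} {a : List Z} (ha : H a) {w : Play Z} (hw : w ∈ cyl a) :
    w ∉ noHit H := by
  intro h
  apply h a.length
  rw [mem_cyl.1 hw]; exact ha

end comb

section top
variable {Z : Type} [TopologicalSpace Z] [DiscreteTopology Z]

lemma isOpen_cyl (p : List Z) : IsOpen (cyl p) := by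
  have : cyl p = ⋂ i : Fin p.length, (fun w : Play Z => w i.1) ⁻¹' {p.get i} := by
    ext w; simp [cyl]
  rw [this]
  exact isOpen_iInter_of_finite fun i => (isOpen_discrete _).preimage (continuous_apply _)

lemma continuous_app (p : List Z) : Continuous (app p) := by
  refine continuous_pi fun i => ?_
  by_cases h : i < p.length
  · simp only [app, h]; exact continuous_const
  · simp only [app, h]; exact continuous_apply _

lemma continuous_tl (n : ℕ) : Continuous (tl n : Play Z → Play Z) :=
  continuous_pi fun i => continuous_apply _

lemma exists_cyl_subset {O : Set (Play Z)} (hO : IsOpen O) {w : Play Z} (hw : w ∈ O) :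
    ∃ n, cyl (pre w n) ⊆ O := by
  rw [isOpen_pi_iff] at hO
  obtain ⟨I, u, hu, hs⟩ := hO w hw
  refine ⟨I.sup id + 1, fun v hv => hs ?_⟩
  intro i hi
  have : i < I.sup id + 1 := Nat.lt_succ_of_le (Finset.le_sup (f := id) hi)
  have h2 := hv ⟨i, by simpa using this⟩
  simp only [List.get_eq_getElem, pre_getElem] at h2
  rw [h2]
  exact (hu i hi).2

end top

section prob
variable {X Y : Type}

lemma cylProb_nil (σ : Strategy (X × Y) X) (τ : Strategy (X × Y) Y) : cylProb σ τ [] = 1 := by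
  simp [cylProb]

lemma cylProb_cons (σ : Strategy (X × Y) X) (τ : Strategy (X × Y) Y) (z : X × Y)
    (q : List (X × Y)) :
    cylProb σ τ (z :: q) = σ [] z.1 * τ [] z.2 * cylProb (sh σ [z]) (sh τ [z]) q := by
  unfold cylProb
  erw [Fin.prod_univ_succ]
  simp [sh]

lemma cylProb_append (σ : Strategy (X × Y) X) (τ : Strategy (X × Y) Y) (p q : List (X × Y)) :
    cylProb σ τ (p ++ q) = cylProb σ τ p * cylProb (sh σ p) (sh τ p) q := by
  induction p generalizing σ τ with
  | nil => simp [cylProb_nil, sh_nil]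
  | cons z p ih =>
    rw [List.cons_append, cylProb_cons, cylProb_cons, ih, ← sh_append, ← sh_append]
    simp [mul_assoc]

lemma cylProb_congr {σ σ' : Strategy (X × Y) X} {τ τ' : Strategy (X × Y) Y} {p : List (X × Y)}
    (h : ∀ k < p.length, σ (p.take k) = σ' (p.take k))
    (h' : ∀ k < p.length, τ (p.take k) = τ' (p.take k)) :
    cylProb σ τ p = cylProb σ' τ' p := by
  unfold cylProb
  refine Finset.prod_congr rfl fun i _ => ?_
  rw [h i.1 i.2, h' i.1 i.2]

variable [Fintype X] [Nonempty X] [Fintype Y] [Nonempty Y]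
    [MeasurableSpace X] [MeasurableSpace Y]
    [MeasurableSingletonClass X] [MeasurableSingletonClass Y]
    [TopologicalSpace X] [DiscreteTopology X]
    [TopologicalSpace Y] [DiscreteTopology Y]
    {μ : Strategy (X × Y) X → Strategy (X × Y) Y → Measure (Play (X × Y))}

lemma borel : BorelSpace (Play (X × Y)) := by infer_instance

lemma meas_cyl (p : List (X × Y)) : MeasurableSet (cyl p) := (isOpen_cyl p).measurableSet

lemma meas_app (p : List (X × Y)) : Measurable (app p : Play (X × Y) → Play (X × Y)) :=
  (continuous_app p).measurable

lemma measure_ext' {m m' : Measure (Play (X × Y))} [IsFiniteMeasure m]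
    (h : ∀ p, m (cyl p) = m' (cyl p)) : m = m' := by
  refine ext_of_generate_finite (Set.range cyl) ?_ ?_ ?_ ?_
  · apply le_antisymm
    · rw [BorelSpace.measurable_eq (α := Play (X × Y)), _root_.borel]
      refine MeasurableSpace.generateFrom_le fun O hO => ?_
      have : O = ⋃ p : {p : List (X × Y) // cyl p ⊆ O}, cyl p.1 := by
        ext w
        simp only [Set.mem_iUnion]
        constructor
        · intro hw
          obtain ⟨n, hn⟩ := exists_cyl_subset hO hw
          exact ⟨⟨_, hn⟩, mem_cyl_pre _ _⟩
        · rintro ⟨p, hp⟩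
          exact p.2 hp
      rw [this]
      exact MeasurableSet.iUnion fun p => MeasurableSpace.measurableSet_generateFrom ⟨_, rfl⟩
    · refine MeasurableSpace.generateFrom_le ?_
      rintro _ ⟨p, rfl⟩
      exact meas_cyl p
  · rintro _ ⟨p, rfl⟩ _ ⟨q, rfl⟩ ⟨w, hp, hq⟩
    rcases prefix_total hp hq with h | h
    · exact ⟨q, (Set.inter_eq_right.2 (cyl_anti h)).symm⟩
    · exact ⟨p, (Set.inter_eq_left.2 (cyl_anti h)).symm⟩
  · rintro _ ⟨p, rfl⟩; exact h p
  · rw [← cyl_nil]; exact h []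

/-- Markov property at a position. -/
lemma cond (hμ : ∀ σ τ, IsInduced σ τ (μ σ τ)) (σ : Strategy (X × Y) X) (τ : Strategy (X × Y) Y)
    (p : List (X × Y)) {B : Set (Play (X × Y))} (hB : MeasurableSet B) :
    μ σ τ (B ∩ cyl p) = cylProb σ τ p * μ (sh σ p) (sh τ p) (app p ⁻¹' B) := by
  have := (hμ σ τ).1
  have := (hμ (sh σ p) (sh τ p)).1
  have key : (μ σ τ).restrict (cyl p)
      = cylProb σ τ p • (μ (sh σ p) (sh τ p)).map (app p) := by
    apply measure_ext'
    intro q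
    rw [Measure.restrict_apply (meas_cyl q), Measure.smul_apply,
      Measure.map_apply (meas_app p) (meas_cyl q), smul_eq_mul]
    by_cases h1 : q <+: p
    · rw [Set.inter_eq_right.2 (cyl_anti h1), (hμ σ τ).2]
      have : app p ⁻¹' cyl q = Set.univ := by
        ext w; simp [cyl_anti h1 (app_mem_cyl p w)]
      rw [this, measure_univ, mul_one]
    · by_cases h2 : p <+: q
      · rw [Set.inter_eq_left.2 (cyl_anti h2), (hμ σ τ).2]
        obtain ⟨r, rfl⟩ := h2
        have : app p ⁻¹' cyl (p ++ r) = cyl r := by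
          ext w; simp [app_mem_cyl_append]
        rw [this, (hμ _ _).2, cylProb_append]
      · have e1 : cyl q ∩ cyl p = ∅ := by
          ext w
          simp only [Set.mem_inter_iff, Set.mem_empty_iff_false, iff_false]
          rintro ⟨ha, hb⟩
          rcases prefix_total ha hb with h | h <;> tauto
        have e2 : app p ⁻¹' cyl q = ∅ := by
          ext w
          simp only [Set.mem_preimage, Set.mem_empty_iff_false, iff_false]
          intro ha
          rcases prefix_total ha (app_mem_cyl p w) with h | h <;> tauto
        rw [e1, e2]; simp
  rw [← Measure.restrict_apply hB, key, Measure.smul_apply, Measure.map_apply (meas_app p) hB,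
    smul_eq_mul]

lemma isClosed_noHit (H : List (X × Y) → Prop) : IsClosed (noHit H) := by
  have : noHit H = (⋃ a : {a // H a}, cyl a.1)ᶜ := by
    ext w
    simp only [Set.mem_compl_iff, Set.mem_iUnion, not_exists]
    constructor
    · intro h a ha; exact not_noHit a.2 ha h
    · intro h k hk; exact h ⟨_, hk⟩ (mem_cyl_pre _ _)
  rw [this]
  exact (isOpen_iUnion fun a => isOpen_cyl _).isClosed_compl

lemma meas_noHit (H : List (X × Y) → Prop) : MeasurableSet (noHit H) :=
  (isClosed_noHit H).measurableSet

/-- partition according to the minimal position in H -/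
lemma split (m : Measure (Play (X × Y))) (H : List (X × Y) → Prop)
    {B : Set (Play (X × Y))} (hB : MeasurableSet B) :
    m B = m (B ∩ noHit H) + ∑' a : mn H, m (B ∩ cyl a.1) := by
  rw [← measure_iUnion, ← measure_union]
  · congr 1
    ext w
    simp only [Set.mem_union, Set.mem_inter_iff, Set.mem_iUnion]
    constructor
    · intro h
      by_cases hw : w ∈ noHit H
      · exact Or.inl ⟨h, hw⟩
      · obtain ⟨a, ha, hwa⟩ := exists_mn hw
        exact Or.inr ⟨⟨a, ha⟩, h, hwa⟩
    · rintro (h | ⟨a, h⟩) <;> exact h.1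
  · rw [Set.disjoint_left]
    rintro w ⟨_, h⟩ h2
    simp only [Set.mem_iUnion] at h2
    obtain ⟨a, h2⟩ := h2
    exact not_noHit a.2.1 h2.2 h
  · exact MeasurableSet.iUnion fun a => hB.inter (meas_cyl _)
  · intro a b hab
    refine Set.disjoint_left.2 ?_
    rintro w ⟨_, h⟩ ⟨_, h2⟩
    exact hab (Subtype.ext (mn_disj a.2 b.2 h h2))
  · exact fun a => hB.inter (meas_cyl _)

/-- strong Markov property -/
lemma markov (hμ : ∀ σ τ, IsInduced σ τ (μ σ τ)) (σ : Strategy (X × Y) X)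
    (τ : Strategy (X × Y) Y) (H : List (X × Y) → Prop)
    {B : Set (Play (X × Y))} (hB : MeasurableSet B) :
    μ σ τ B = μ σ τ (B ∩ noHit H) +
      ∑' a : mn H, cylProb σ τ a.1 * μ (sh σ a.1) (sh τ a.1) (app a.1 ⁻¹' B) := by
  rw [split (μ σ τ) H hB]
  congr 1
  exact tsum_congr fun a => cond hμ σ τ a.1 hB

lemma tsum_cylProb_le (hμ : ∀ σ τ, IsInduced σ τ (μ σ τ)) (σ : Strategy (X × Y) X)
    (τ : Strategy (X × Y) Y) (H : List (X × Y) → Prop) :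
    ∑' a : mn H, cylProb σ τ a.1 ≤ 1 := by
  have := (hμ σ τ).1
  have := split (μ σ τ) H MeasurableSet.univ
  rw [measure_univ] at this
  rw [this]
  refine le_trans (ENNReal.tsum_le_tsum fun a => ?_) le_add_self
  rw [Set.univ_inter, (hμ σ τ).2]

/-- locality: only what is played before H is met matters -/
lemma local_cyl {σ σ' : Strategy (X × Y) X} {τ τ' : Strategy (X × Y) Y}
    {H : List (X × Y) → Prop} (hH : ∀ p q, p <+: q → H p → H q)
    (h : ∀ q, ¬ H q → σ q = σ' q) (h' : ∀ q, ¬ H q → τ q = τ' q) {a : List (X × Y)}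
    (ha : ∀ k < a.length, ¬ H (a.take k)) : cylProb σ τ a = cylProb σ' τ' a :=
  cylProb_congr (fun k hk => h _ (ha k hk)) (fun k hk => h' _ (ha k hk))

lemma local_noHit (hμ : ∀ σ τ, IsInduced σ τ (μ σ τ))
    {σ σ' : Strategy (X × Y) X} {τ τ' : Strategy (X × Y) Y}
    {H : List (X × Y) → Prop} (hH : ∀ p q, p <+: q → H p → H q)
    (h : ∀ q, ¬ H q → σ q = σ' q) (h' : ∀ q, ¬ H q → τ q = τ' q) 
    {B : Set (Play (X × Y))} (hB : MeasurableSet B) :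
    μ σ τ (B ∩ noHit H) = μ σ' τ' (B ∩ noHit H) := by
  have := (hμ σ τ).1
  have := (hμ σ' τ').1
  have key : (μ σ τ).restrict (noHit H) = (μ σ' τ').restrict (noHit H) := by
    apply measure_ext'
    intro p
    rw [Measure.restrict_apply (meas_cyl p), Measure.restrict_apply (meas_cyl p)]
    by_cases hp : H p
    · have : cyl p ∩ noHit H = ∅ := by
        ext w
        simp only [Set.mem_inter_iff, Set.mem_empty_iff_false, iff_false]
        rintro ⟨ha, hb⟩
        exact not_noHit hp ha hb
      rw [this]; simp
    · have hpre : ∀ k < p.length, ¬ H (p.take k) :=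
        fun k _ hk => hp (hH _ _ (List.take_prefix _ _) hk)
      have e1 := split (μ σ τ) H (meas_cyl p)
      have e2 := split (μ σ' τ') H (meas_cyl p)
      have e3 : ∑' a : mn H, μ σ τ (cyl p ∩ cyl a.1) = ∑' a : mn H, μ σ' τ' (cyl p ∩ cyl a.1) := by
        refine tsum_congr fun a => ?_
        by_cases hpa : p <+: a.1
        · rw [Set.inter_eq_right.2 (cyl_anti hpa), (hμ _ _).2, (hμ _ _).2]
          exact local_cyl hH h h' a.2.2
        · have : cyl p ∩ cyl a.1 = ∅ := by
            ext w
            simp only [Set.mem_inter_iff, Set.mem_empty_iff_false, iff_false]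
            rintro ⟨ha, hb⟩
            rcases prefix_total ha hb with h | h
            · exact hpa h
            · exact hp (hH _ _ h a.2.1)
          rw [this]; simp
      rw [(hμ _ _).2, local_cyl hH h h' hpre, ← (hμ _ _).2, e2, ← e3] at e1
      have hfin : ∑' a : mn H, μ σ τ (cyl p ∩ cyl a.1) ≠ ⊤ := by
        intro ht
        have := split (μ σ τ) H (meas_cyl p)
        rw [ht, add_top] at this
        exact measure_ne_top _ _ this
      exact ((ENNReal.add_left_inj hfin).1 e1).symm
  rw [← Measure.restrict_apply hB, key, Measure.restrict_apply hB]


lemma approx_iInf {ι : Type} [Nonempty ι] {f : ι → ENNReal} {c ε : ENNReal} (h : ⨅ i, f i ≤ c)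
    (hc : c ≠ ⊤) (hε : ε ≠ 0) : ∃ i, f i ≤ c + ε := by
  have : ⨅ i, f i < c + ε := lt_of_le_of_lt h (ENNReal.lt_add_right hc hε)
  obtain ⟨i, hi⟩ := iInf_lt_iff.1 this
  exact ⟨i, hi.le⟩

lemma approx_iSup {ι : Type} [Nonempty ι] {f : ι → ENNReal} {c ε : ENNReal} (h : c ≤ ⨆ i, f i)
    (hc : c ≠ ⊤) (hε : ε ≠ 0) : ∃ i, c ≤ f i + ε := by
  by_contra! hcon
  have i0 : ι := Classical.arbitrary ι
  have hε' : ε < c := lt_of_le_of_lt le_add_self (hcon i0)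
  have h1 : ⨆ i, f i ≤ c - ε := iSup_le fun i => ENNReal.le_sub_of_add_le_right hε'.ne_top (hcon i).le
  have h2 : c - ε < c := ENNReal.sub_lt_self hc (by rintro rfl; simp at hε') hε
  exact absurd (h.trans h1) (not_le.2 h2)

instance {M : Type} [Nonempty M] : Nonempty (PMF M) := ⟨PMF.pure (Classical.arbitrary M)⟩

open Classical in
/-- glue strategies at the first time H is met -/
noncomputable def glue {Z M : Type} (H : List Z → Prop) (s : Strategy Z M)
    (f : List Z → Strategy Z M) : Strategy Z M := fun q =>
  if h : ∃ k, H (q.take k) then f (q.take (Nat.find h)) (q.drop (Nat.find h)) else s q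

lemma glue_not {Z M : Type} {H : List Z → Prop} (hH : ∀ p q, p <+: q → H p → H q)
    (s : Strategy Z M) (f : List Z → Strategy Z M) (q : List Z) (hq : ¬ H q) :
    glue H s f q = s q := by
  classical
  have : ¬ ∃ k, H (q.take k) := by
    rintro ⟨k, hk⟩
    exact hq (hH _ _ (List.take_prefix _ _) hk)
  simp [glue, this]

lemma glue_find {Z : Type} {H : List Z → Prop} [DecidablePred fun k => H k] {a : List Z} (ha : a ∈ mn H) (r : List Z)
    [DecidablePred fun k => H ((a ++ r).take k)]
    (h : ∃ k, H ((a ++ r).take k)) : Nat.find h = a.length := by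
  rw [Nat.find_eq_iff]
  constructor
  · simpa using ha.1
  · intro k hk
    rw [List.take_append_of_le_length hk.le]
    exact ha.2 k hk

lemma sh_glue {Z M : Type} {H : List Z → Prop} 
    (s : Strategy Z M) (f : List Z → Strategy Z M) {a : List Z} (ha : a ∈ mn H) :
    sh (glue H s f) a = f a := by
  classical
  funext r
  have h : ∃ k, H ((a ++ r).take k) := ⟨a.length, by simpa using ha.1⟩
  have e := glue_find ha r h
  simp only [sh, glue, h, dif_pos]
  rw [e]
  simp

variable (μ) in
/-- lower value -/
noncomputable def L (B : Set (Play (X × Y))) : ENNReal := ⨆ σ, ⨅ τ, μ σ τ B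

variable (μ) in
/-- best outer open value -/
noncomputable def gv (S D : Set (Play (X × Y))) : ENNReal :=
  ⨅ O : {O : Set (Play (X × Y)) // IsOpen O ∧ D ⊆ O}, L μ (S ∪ O.1)

variable (μ) in
/-- auxiliary payoff -/
noncomputable def J (S D : Set (Play (X × Y))) (H : List (X × Y) → Prop)
    (σ : Strategy (X × Y) X) (τ : Strategy (X × Y) Y) : ENNReal :=
  μ σ τ (S ∩ noHit H) +
    ∑' a : mn H, cylProb σ τ a.1 * gv μ (app a.1 ⁻¹' S) (app a.1 ⁻¹' D)

lemma L_le_one (hμ : ∀ σ τ, IsInduced σ τ (μ σ τ)) (B : Set (Play (X × Y))) : L μ B ≤ 1 := by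
  refine iSup_le fun σ => iInf_le_of_le (Classical.arbitrary _) ?_
  have := (hμ σ (Classical.arbitrary _)).1
  exact prob_le_one

lemma L_mono {B C : Set (Play (X × Y))} (h : B ⊆ C) : L μ B ≤ L μ C :=
  iSup_mono fun σ => iInf_mono fun τ => measure_mono h

lemma gv_le_one (hμ : ∀ σ τ, IsInduced σ τ (μ σ τ)) (S D : Set (Play (X × Y))) :
    gv μ S D ≤ 1 :=
  iInf_le_of_le ⟨Set.univ, isOpen_univ, Set.subset_univ _⟩ (L_le_one hμ _)

instance (D : Set (Play (X × Y))) : Nonempty {O : Set (Play (X × Y)) // IsOpen O ∧ D ⊆ O} :=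
  ⟨⟨Set.univ, isOpen_univ, Set.subset_univ _⟩⟩

/-- Step I -/
lemma stepI (hμ : ∀ σ τ, IsInduced σ τ (μ σ τ)) {S D : Set (Play (X × Y))}
    (hS : MeasurableSet S) {H : List (X × Y) → Prop} (hH : ∀ p q, p <+: q → H p → H q)
    (hD : ∀ w ∈ D, w ∉ noHit H) : gv μ S D ≤ ⨆ σ, ⨅ τ, J μ S D H σ τ := by
  refine ENNReal.le_of_forall_pos_le_add fun ε hε _ => ?_
  have hε2 : (ε : ENNReal) / 2 ≠ 0 := by simp [hε.ne']
  have hO : ∀ a : List (X × Y), ∃ O : Set (Play (X × Y)), (IsOpen O ∧ app a ⁻¹' D ⊆ O) ∧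
      L μ (app a ⁻¹' S ∪ O) ≤ gv μ (app a ⁻¹' S) (app a ⁻¹' D) + ε / 2 := by
    intro a
    obtain ⟨O, hO⟩ := approx_iInf (le_refl (gv μ (app a ⁻¹' S) (app a ⁻¹' D)))
      (ne_top_of_le_ne_top ENNReal.one_ne_top (gv_le_one hμ _ _)) hε2
    exact ⟨O.1, O.2, hO⟩
  choose O hO1 hO2 using hO
  set U : Set (Play (X × Y)) := ⋃ a : mn H, (cyl a.1 ∩ tl a.1.length ⁻¹' O a.1) with hU
  have hUo : IsOpen U := isOpen_iUnion fun a =>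
    (isOpen_cyl _).inter ((hO1 a.1).1.preimage (continuous_tl _))
  have hDU : D ⊆ U := by
    intro w hw
    obtain ⟨a, ha, hwa⟩ := exists_mn (hD w hw)
    refine Set.mem_iUnion.2 ⟨⟨a, ha⟩, hwa, (hO1 a).2 ?_⟩
    rw [Set.mem_preimage, app_tl hwa]; exact hw
  have hUa : ∀ a ∈ mn H, app a ⁻¹' U = O a := by
    intro a ha
    ext w
    simp only [Set.mem_preimage, hU, Set.mem_iUnion, Set.mem_inter_iff]
    constructor
    · rintro ⟨b, hb1, hb2⟩
      have : a = b.1 := mn_disj ha b.2 (app_mem_cyl a w) hb1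
      rw [← this, tl_app] at hb2
      exact hb2
    · intro h
      exact ⟨⟨a, ha⟩, app_mem_cyl _ _, by rw [tl_app]; exact h⟩
  have hUn : (S ∪ U) ∩ noHit H = S ∩ noHit H := by
    ext w
    simp only [Set.mem_inter_iff, Set.mem_union]
    constructor
    · rintro ⟨h | h, h2⟩
      · exact ⟨h, h2⟩
      · obtain ⟨a, ha⟩ := Set.mem_iUnion.1 h
        exact absurd h2 (not_noHit a.2.1 ha.1)
    · rintro ⟨h, h2⟩; exact ⟨Or.inl h, h2⟩
  have h1 : gv μ S D ≤ L μ (S ∪ U) := iInf_le_of_le ⟨U, hUo, hDU⟩ le_rfl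
  refine h1.trans ?_
  rw [L, ENNReal.iSup_add]
  refine iSup_mono fun σ => ?_
  rw [ENNReal.iInf_add]
  refine le_iInf fun τ => ?_
  have hτ : ∀ a : List (X × Y), ∃ t, μ (sh σ a) t (app a ⁻¹' S ∪ O a) ≤
      L μ (app a ⁻¹' S ∪ O a) + ε / 2 := by
    intro a
    exact approx_iInf (le_iSup (fun s => ⨅ t, μ s t (app a ⁻¹' S ∪ O a)) (sh σ a))
      (ne_top_of_le_ne_top ENNReal.one_ne_top (L_le_one hμ _)) hε2
  choose t ht using hτ
  refine iInf_le_of_le (glue H τ t) ?_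
  rw [markov hμ σ (glue H τ t) H (hS.union hUo.measurableSet), hUn,
    local_noHit hμ hH (fun q _ => rfl) (fun q hq => glue_not hH τ t q hq) hS, J, add_assoc]
  gcongr
  calc ∑' a : mn H, cylProb σ (glue H τ t) a.1 *
        μ (sh σ a.1) (sh (glue H τ t) a.1) (app a.1 ⁻¹' (S ∪ U))
      ≤ ∑' a : mn H, (cylProb σ τ a.1 * gv μ (app a.1 ⁻¹' S) (app a.1 ⁻¹' D)
          + cylProb σ τ a.1 * ε) := by
        refine ENNReal.tsum_le_tsum fun a => ?_
        rw [sh_glue τ t a.2, Set.preimage_union, hUa a.1 a.2,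
          local_cyl hH (fun q _ => rfl) (fun q hq => glue_not hH τ t q hq) a.2.2, ← mul_add]
        gcongr
        refine (ht a.1).trans ((add_le_add_left (hO2 a.1) _).trans ?_)
        rw [add_assoc, ENNReal.add_halves]
    _ = ∑' a : mn H, cylProb σ τ a.1 * gv μ (app a.1 ⁻¹' S) (app a.1 ⁻¹' D)
          + (∑' a : mn H, cylProb σ τ a.1) * ε := by
        rw [ENNReal.tsum_add, ENNReal.tsum_mul_right]
    _ ≤ _ := by
        gcongr
        calc _ ≤ 1 * (ε : ENNReal) := by gcongr; exact tsum_cylProb_le hμ σ τ H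
          _ = ε := one_mul _

lemma J_local (hμ : ∀ σ τ, IsInduced σ τ (μ σ τ)) {S D : Set (Play (X × Y))}
    (hS : MeasurableSet S) {H : List (X × Y) → Prop} (hH : ∀ p q, p <+: q → H p → H q)
    {σ σ' : Strategy (X × Y) X} (τ : Strategy (X × Y) Y)
    (h : ∀ q, ¬ H q → σ q = σ' q) : J μ S D H σ τ = J μ S D H σ' τ := by
  rw [J, J, local_noHit hμ hH h (fun q _ => rfl) hS]
  congr 1
  refine tsum_congr fun a => ?_
  rw [local_cyl hH h (fun q _ => rfl) a.2.2]

/-- refining the stopping time -/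
lemma J_refine (hμ : ∀ σ τ, IsInduced σ τ (μ σ τ)) {S D : Set (Play (X × Y))}
    (hS : MeasurableSet S) {H H' : List (X × Y) → Prop}
    (hHH : ∀ p, H' p → H p) (hH : ∀ p q, p <+: q → H p → H q)
    (σ : Strategy (X × Y) X) (τ : Strategy (X × Y) Y) :
    μ σ τ (S ∩ noHit H) + ∑' a : mn H, cylProb σ τ a.1 *
      J μ (app a.1 ⁻¹' S) (app a.1 ⁻¹' D) (fun r => H' (a.1 ++ r)) (sh σ a.1) (sh τ a.1)
      ≤ J μ S D H' σ τ := by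
  have hno : ∀ a ∈ mn H, app a ⁻¹' S ∩ noHit (fun r => H' (a ++ r))
      = app a ⁻¹' (S ∩ noHit H') := by
    intro a ha
    ext w
    simp only [Set.mem_inter_iff, Set.mem_preimage, noHit, Set.mem_ofPred_eq, and_congr_right_iff]
    intro _
    constructor
    · intro h k hk
      rcases lt_or_ge k a.length with hka | hka
      · rw [pre_app_le _ _ _ hka.le] at hk
        exact ha.2 k hka (hHH _ hk)
      · obtain ⟨j, rfl⟩ := Nat.exists_eq_add_of_le hka
        rw [pre_app_add] at hk
        exact h j hk
    · intro h k hk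
      apply h (a.length + k)
      rw [pre_app_add]; exact hk
  have hnn : (S ∩ noHit H') ∩ noHit H = S ∩ noHit H := by
    ext w
    simp only [Set.mem_inter_iff, noHit, Set.mem_ofPred_eq]
    constructor
    · rintro ⟨⟨h1, h2⟩, h3⟩; exact ⟨h1, h3⟩
    · rintro ⟨h1, h3⟩; exact ⟨⟨h1, fun k hk => h3 k (hHH _ hk)⟩, h3⟩
  have hmem : ∀ (a : mn H) (r : mn (fun r => H' (a.1 ++ r))), a.1 ++ r.1 ∈ mn H' := by
    intro a r
    refine ⟨r.2.1, fun k hk hk' => ?_⟩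
    rcases lt_or_ge k a.1.length with hka | hka
    · rw [List.take_append_of_le_length hka.le] at hk'
      exact a.2.2 k hka (hHH _ hk')
    · obtain ⟨j, rfl⟩ := Nat.exists_eq_add_of_le hka
      rw [List.take_length_add_append] at hk'
      refine r.2.2 j ?_ hk'
      simpa using hk
  have hinj : Function.Injective (fun x : (Σ a : mn H, mn (fun r => H' (a.1 ++ r))) =>
      (⟨x.1.1 ++ x.2.1, hmem x.1 x.2⟩ : mn H')) := by
    rintro ⟨⟨a, ha⟩, ⟨r, hr⟩⟩ ⟨⟨b, hb⟩, ⟨s, hs⟩⟩ h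
    simp only [Subtype.mk.injEq] at h
    have hab : a = b := by
      have h1 : a <+: b ++ s := ⟨r, h⟩
      have h2 : b <+: b ++ s := List.prefix_append _ _
      rcases List.prefix_or_prefix_of_prefix h1 h2 with h | h
      · exact mn_prefix ha hb h
      · exact (mn_prefix hb ha h).symm
    subst hab
    have : r = s := List.append_cancel_left h
    subst this
    rfl
  have e := markov hμ σ τ H (hS.inter (meas_noHit H'))
  rw [hnn] at e
  rw [J, e, add_assoc]
  gcongr
  have e1 : ∀ a : mn H, cylProb σ τ a.1 *
      J μ (app a.1 ⁻¹' S) (app a.1 ⁻¹' D) (fun r => H' (a.1 ++ r)) (sh σ a.1) (sh τ a.1) =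
      cylProb σ τ a.1 * μ (sh σ a.1) (sh τ a.1) (app a.1 ⁻¹' (S ∩ noHit H')) +
      ∑' r : mn (fun r => H' (a.1 ++ r)), cylProb σ τ (a.1 ++ r.1) *
        gv μ (app (a.1 ++ r.1) ⁻¹' S) (app (a.1 ++ r.1) ⁻¹' D) := by
    intro a
    rw [J, mul_add, hno a.1 a.2, ← ENNReal.tsum_mul_left]
    congr 1
    refine tsum_congr fun r => ?_
    have e2 : ∀ T : Set (Play (X × Y)), app (a.1 ++ r.1) ⁻¹' T = app r.1 ⁻¹' (app a.1 ⁻¹' T) := by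
      intro T; ext w; simp [app_append]
    rw [cylProb_append, e2, e2, mul_assoc]
  simp_rw [e1]
  rw [ENNReal.tsum_add]
  gcongr
  rw [← ENNReal.tsum_sigma (fun (a : mn H) (r : mn (fun r => H' (a.1 ++ r))) =>
    cylProb σ τ (a.1 ++ r.1) * gv μ (app (a.1 ++ r.1) ⁻¹' S) (app (a.1 ++ r.1) ⁻¹' D))]
  exact ENNReal.tsum_comp_le_tsum_of_injective hinj (fun b : mn H' => cylProb σ τ b.1 *
    gv μ (app b.1 ⁻¹' S) (app b.1 ⁻¹' D))

lemma J_le (hμ : ∀ σ τ, IsInduced σ τ (μ σ τ)) {S D : Set (Play (X × Y))}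
    (hS : MeasurableSet S) (H : List (X × Y) → Prop)
    (σ : Strategy (X × Y) X) (τ : Strategy (X × Y) Y) :
    J μ S D H σ τ ≤ μ σ τ (S ∪ (noHit H)ᶜ) := by
  rw [split (μ σ τ) H (hS.union (meas_noHit H).compl), J]
  gcongr with a
  · exact Set.subset_union_left
  · calc _ ≤ cylProb σ τ a.1 * 1 := by gcongr; exact gv_le_one hμ _ _
      _ = μ σ τ (cyl a.1) := by rw [mul_one, (hμ σ τ).2]
      _ ≤ μ σ τ ((S ∪ (noHit H)ᶜ) ∩ cyl a.1) :=
          measure_mono fun w hw => ⟨Or.inr (not_noHit a.2.1 hw), hw⟩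

/-- Step II -/
lemma stepII (hμ : ∀ σ τ, IsInduced σ τ (μ σ τ)) {S D : Set (Play (X × Y))}
    (hS : MeasurableSet S) (hD : IsGδ D) : gv μ S D ≤ L μ (S ∪ D) := by
  classical
  obtain ⟨U, hUo, hDU⟩ := isGδ_iff_eq_iInter_nat.1 hD
  set H : ℕ → List (X × Y) → Prop := fun n p => n ≤ p.length ∧ ∀ k < n, cyl p ⊆ U k with hHdef
  have hup : ∀ n p q, p <+: q → H n p → H n q := fun n p q hpq h =>
    ⟨h.1.trans hpq.length_le, fun k hk => (cyl_anti hpq).trans (h.2 k hk)⟩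
  have hanti : ∀ n p, H (n + 1) p → H n p := fun n p h =>
    ⟨by have := h.1; omega, fun k hk => h.2 k (by omega)⟩
  have hanti' : ∀ n m p, n ≤ m → H m p → H n p := fun n m p hnm h =>
    ⟨hnm.trans h.1, fun k hk => h.2 k (by omega)⟩
  have hhit : ∀ n w, w ∉ noHit (H n) ↔ ∀ k < n, w ∈ U k := by
    intro n w
    constructor
    · intro h k hk
      obtain ⟨a, ha, hwa⟩ := exists_mn h
      exact ha.1.2 k hk hwa
    · intro h hno
      have : ∀ n' ≤ n, ∃ m, ∀ k < n', cyl (pre w m) ⊆ U k := by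
        intro n' hn'
        induction n' with
        | zero => exact ⟨0, fun k hk => absurd hk (by omega)⟩
        | succ j ih =>
          obtain ⟨m, hm⟩ := ih (by omega)
          obtain ⟨m', hm'⟩ := exists_cyl_subset (hUo j) (h j (by omega))
          refine ⟨max m m', fun k hk => ?_⟩
          rcases Nat.lt_succ_iff_lt_or_eq.1 hk with hk | rfl
          · exact (cyl_anti (pre_prefix w (le_max_left _ _))).trans (hm k hk)
          · exact (cyl_anti (pre_prefix w (le_max_right _ _))).trans hm'
      obtain ⟨m, hm⟩ := this n le_rfl
      refine hno (max m n) ⟨by simp, fun k hk => ?_⟩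
      exact (cyl_anti (pre_prefix w (le_max_left _ _))).trans (hm k hk)
  refine ENNReal.le_of_forall_pos_le_add fun ε hε _ => ?_
  obtain ⟨δ, hδ0, hδ⟩ := ENNReal.exists_pos_sum_of_countable'
    (ε := (ε : ENNReal)) (by simp [hε.ne']) ℕ
  have hex : ∀ (n : ℕ) (a : List (X × Y)), ∃ s : Strategy (X × Y) X, ∀ t,
      gv μ (app a ⁻¹' S) (app a ⁻¹' D) ≤
        J μ (app a ⁻¹' S) (app a ⁻¹' D) (fun r => H (n + 1) (a ++ r)) s t + δ n := by
    intro n a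
    have h1 := stepI hμ (S := app a ⁻¹' S) (D := app a ⁻¹' D) (meas_app a hS)
      (H := fun r => H (n + 1) (a ++ r))
      (fun p q hpq => hup _ _ _ ((List.prefix_append_right_inj a).2 hpq)) (by
        intro w hw hno
        have hw' : app a w ∉ noHit (H (n + 1)) := by
          rw [hhit]
          intro k _
          rw [Set.mem_preimage, hDU] at hw
          exact Set.mem_iInter.1 hw k
        apply hw'
        intro k hk
        have := hup _ _ _ (pre_prefix (app a w) (Nat.le_add_left k a.length)) hk
        rw [pre_app_add] at this
        exact hno k this)
    obtain ⟨s, hs⟩ := approx_iSup h1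
      (ne_top_of_le_ne_top ENNReal.one_ne_top (gv_le_one hμ _ _)) (hδ0 n).ne'
    exact ⟨s, fun t => hs.trans (by gcongr; exact iInf_le _ t)⟩
  choose s hs using hex
  set σ : Strategy (X × Y) X := fun q =>
    glue (H (Nat.findGreatest (fun n => H n q) q.length)) (Classical.arbitrary _)
      (s (Nat.findGreatest (fun n => H n q) q.length)) q with hσ
  have hσs : ∀ n, ∀ a ∈ mn (H n), ∀ r, ¬ H (n + 1) (a ++ r) → sh σ a r = s n a r := by
    intro n a ha r hr
    have hf : Nat.findGreatest (fun n => H n (a ++ r)) (a ++ r).length = n := by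
      have h1 : H n (a ++ r) := hup n _ _ (List.prefix_append a r) ha.1
      have h2 : n ≤ Nat.findGreatest (fun n => H n (a ++ r)) (a ++ r).length :=
        Nat.le_findGreatest h1.1 h1
      have h3 : H (Nat.findGreatest (fun n => H n (a ++ r)) (a ++ r).length) (a ++ r) :=
        Nat.findGreatest_spec (P := fun n => H n (a ++ r)) h1.1 h1
      by_contra hne
      exact hr (hanti' (n + 1) _ _ (by omega) h3)
    simp only [sh, hσ]
    rw [hf]
    exact congrFun (sh_glue (H := H n) (Classical.arbitrary _) (s n) ha) r
  suffices hsuff : ∀ τ, gv μ S D ≤ μ σ τ (S ∪ D) + ε by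
    refine le_trans (b := (⨅ τ, μ σ τ (S ∪ D)) + ε) ?_ ?_
    · rw [ENNReal.iInf_add]; exact le_iInf hsuff
    · gcongr
      exact le_iSup (fun σ => ⨅ τ, μ σ τ (S ∪ D)) σ
  intro τ
  have := (hμ σ τ).1
  have hJ : ∀ n, gv μ S D ≤ J μ S D (H n) σ τ + ∑ k ∈ Finset.range n, δ k := by
    intro n
    induction n with
    | zero =>
      have hm : ([] : List (X × Y)) ∈ mn (H 0) := ⟨⟨by simp, by simp⟩, by simp⟩
      have h1 := ENNReal.le_tsum (f := fun a : ↥(mn (H 0)) => cylProb σ τ a.1 *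
        gv μ (app a.1 ⁻¹' S) (app a.1 ⁻¹' D)) (⟨[], hm⟩ : mn (H 0))
      have e : ∀ T : Set (Play (X × Y)), app [] ⁻¹' T = T := by
        intro T; ext w; simp [app_nil]
      simp only [cylProb_nil, e, one_mul] at h1
      rw [Finset.range_zero, Finset.sum_empty, add_zero]
      exact h1.trans le_add_self
    | succ n ih =>
      refine ih.trans ?_
      rw [Finset.sum_range_succ, add_comm _ (δ n), ← add_assoc]
      gcongr
      refine le_trans ?_ (add_le_add_left (J_refine hμ hS (hanti n) (hup n) σ τ) (δ n))
      rw [J, add_assoc]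
      gcongr
      calc ∑' a : mn (H n), cylProb σ τ a.1 * gv μ (app a.1 ⁻¹' S) (app a.1 ⁻¹' D)
          ≤ ∑' a : mn (H n), (cylProb σ τ a.1 *
            J μ (app a.1 ⁻¹' S) (app a.1 ⁻¹' D) (fun r => H (n + 1) (a.1 ++ r))
              (sh σ a.1) (sh τ a.1) + cylProb σ τ a.1 * δ n) := by
            refine ENNReal.tsum_le_tsum fun a => ?_
            rw [← mul_add]
            gcongr
            rw [J_local hμ (meas_app a.1 hS)
              (fun p q hpq => hup _ _ _ ((List.prefix_append_right_inj a.1).2 hpq)) (sh τ a.1)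
              (hσs n a.1 a.2)]
            exact hs n a.1 (sh τ a.1)
        _ ≤ _ := by
            rw [ENNReal.tsum_add, ENNReal.tsum_mul_right]
            gcongr
            calc _ ≤ 1 * δ n := by gcongr; exact tsum_cylProb_le hμ σ τ _
              _ = δ n := one_mul _
  have hlim : μ σ τ (S ∪ D) = ⨅ n, μ σ τ (S ∪ (noHit (H n))ᶜ) := by
    rw [← Antitone.measure_iInter]
    · congr 1
      rw [← Set.union_iInter]
      congr 1
      ext w
      simp only [Set.mem_iInter, Set.mem_compl_iff, hhit, hDU]
      exact ⟨fun h n k _ => h k, fun h k => h (k + 1) k (by omega)⟩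
    · intro n m hnm
      refine Set.union_subset_union_right _ fun w hw => ?_
      rw [Set.mem_compl_iff, hhit] at *
      exact fun k hk => hw k (by omega)
    · exact fun n => (hS.union (meas_noHit _).compl).nullMeasurableSet
    · exact ⟨0, measure_ne_top _ _⟩
  rw [hlim, ENNReal.iInf_add]
  refine le_iInf fun n => (hJ n).trans ?_
  gcongr
  · exact J_le hμ hS _ σ τ
  · exact (ENNReal.sum_le_tsum _).trans hδ.le

lemma stepR (hμ : ∀ σ τ, IsInduced σ τ (μ σ τ)) {S D : Set (Play (X × Y))}
    (hS : MeasurableSet S) (hD : IsGδ D) {ε : ENNReal} (hε : ε ≠ 0) :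
    ∃ O, IsOpen O ∧ D ⊆ O ∧ L μ (S ∪ O) ≤ L μ (S ∪ D) + ε := by
  obtain ⟨O, hO⟩ := approx_iInf (stepII hμ hS hD)
    (ne_top_of_le_ne_top ENNReal.one_ne_top (L_le_one hμ _)) hε
  exact ⟨O.1, O.2.1, O.2.2, hO⟩

lemma pmf_sum {M : Type} [Fintype M] (x : PMF M) : ∑ a, x a = 1 := by
  rw [← tsum_fintype (L := .unconditional _)]; exact x.tsum_coe

/-- minimax alternative -/
lemma minimax_alt (M : X → Y → ENNReal) (hM : ∀ a b, M a b ≤ 1) (c : ENNReal) :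
    (∃ x : PMF X, ∀ b, c < ∑ a, x a * M a b) ∨ (∃ y : PMF Y, ∀ a, ∑ b, y b * M a b ≤ c) := by
  classical
  have hMt : ∀ a b, M a b ≠ ⊤ := fun a b => ne_top_of_le_ne_top ENNReal.one_ne_top (hM a b)
  let f : (Y → ℝ) → (X → ℝ) → ℝ := fun y x => ∑ a, ∑ b, x a * y b * (M a b).toReal
  have hc1 : ∀ x, Continuous fun y => f y x := fun x => by fun_prop
  have hc2 : ∀ y, Continuous fun x => f y x := fun y => by fun_prop
  have hl1 : ∀ x, IsLinearMap ℝ (fun y => f y x) := fun x =>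
    { map_add := fun u v => by
        simp only [f, ← Finset.sum_add_distrib]
        refine Finset.sum_congr rfl fun a _ => Finset.sum_congr rfl fun b _ => ?_
        simp only [Pi.add_apply]; ring
      map_smul := fun r u => by
        simp only [f, smul_eq_mul, Finset.mul_sum]
        refine Finset.sum_congr rfl fun a _ => Finset.sum_congr rfl fun b _ => ?_
        simp only [Pi.smul_apply, smul_eq_mul]; ring }
  have hl2 : ∀ y, IsLinearMap ℝ (fun x => f y x) := fun x =>
    { map_add := fun u v => by
        simp only [f, ← Finset.sum_add_distrib]
        refine Finset.sum_congr rfl fun a _ => Finset.sum_congr rfl fun b _ => ?_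
        simp only [Pi.add_apply]; ring
      map_smul := fun r u => by
        simp only [f, smul_eq_mul, Finset.mul_sum]
        refine Finset.sum_congr rfl fun a _ => Finset.sum_congr rfl fun b _ => ?_
        simp only [Pi.smul_apply, smul_eq_mul]; ring }
  have nX : (stdSimplex ℝ X).Nonempty := ⟨_, single_mem_stdSimplex ℝ (Classical.arbitrary X)⟩
  have nY : (stdSimplex ℝ Y).Nonempty := ⟨_, single_mem_stdSimplex ℝ (Classical.arbitrary Y)⟩
  obtain ⟨y, hy, x, hx, hs⟩ := Sion.exists_isSaddlePointOn (f := f) nY (convex_stdSimplex ℝ Y)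
    (isCompact_stdSimplex ℝ Y)
    (fun x _ => (hc1 x).lowerSemicontinuous.lowerSemicontinuousOn _)
    (fun x _ => (((hl1 x).mk' _).convexOn (convex_stdSimplex ℝ Y)).quasiconvexOn)
    (convex_stdSimplex ℝ X) nX (isCompact_stdSimplex ℝ X)
    (fun y _ => (hc2 y).upperSemicontinuous.upperSemicontinuousOn _)
    (fun y _ => (((hl2 y).mk' _).concaveOn (convex_stdSimplex ℝ X)).quasiconcaveOn)
  let px : PMF X := PMF.ofFintype (fun a => ENNReal.ofReal (x a)) (by
    rw [← ENNReal.ofReal_sum_of_nonneg fun a _ => hx.1 a, hx.2, ENNReal.ofReal_one])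
  let py : PMF Y := PMF.ofFintype (fun a => ENNReal.ofReal (y a)) (by
    rw [← ENNReal.ofReal_sum_of_nonneg fun a _ => hy.1 a, hy.2, ENNReal.ofReal_one])
  have ex : ∀ b, ∑ a, px a * M a b = ENNReal.ofReal (f (Pi.single b 1) x) := by
    intro b
    have : f (Pi.single b 1) x = ∑ a, x a * (M a b).toReal := by
      refine Finset.sum_congr rfl fun a _ => ?_
      rw [Finset.sum_eq_single b]
      · simp
      · intro b' _ h; simp [h]
      · simp
    rw [this, ENNReal.ofReal_sum_of_nonneg fun a _ => mul_nonneg (hx.1 a) ENNReal.toReal_nonneg]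
    refine Finset.sum_congr rfl fun a _ => ?_
    rw [ENNReal.ofReal_mul (hx.1 a), ENNReal.ofReal_toReal (hMt a b)]
    rfl
  have ey : ∀ a, ∑ b, py b * M a b = ENNReal.ofReal (f y (Pi.single a 1)) := by
    intro a
    have : f y (Pi.single a 1) = ∑ b, y b * (M a b).toReal := by
      simp only [f]
      rw [Finset.sum_eq_single a]
      · simp
      · intro b' _ h; simp [h]
      · simp
    rw [this, ENNReal.ofReal_sum_of_nonneg fun a _ => mul_nonneg (hy.1 a) ENNReal.toReal_nonneg]
    refine Finset.sum_congr rfl fun b _ => ?_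
    rw [ENNReal.ofReal_mul (hy.1 b), ENNReal.ofReal_toReal (hMt a b)]
    rfl
  rcases lt_or_ge c (ENNReal.ofReal (f y x)) with h | h
  · left
    refine ⟨px, fun b => ?_⟩
    rw [ex]
    exact h.trans_le (ENNReal.ofReal_le_ofReal (hs _ (single_mem_stdSimplex ℝ b) _ hx))
  · right
    refine ⟨py, fun a => ?_⟩
    rw [ey]
    exact (ENNReal.ofReal_le_ofReal (hs _ hy _ (single_mem_stdSimplex ℝ a))).trans h

lemma one_step (hμ : ∀ σ τ, IsInduced σ τ (μ σ τ)) (σ : Strategy (X × Y) X)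
    (τ : Strategy (X × Y) Y) {B : Set (Play (X × Y))} (hB : MeasurableSet B) :
    μ σ τ B = ∑ b, ∑ a, σ [] a * τ [] b *
      μ (sh σ [(a, b)]) (sh τ [(a, b)]) (app [(a, b)] ⁻¹' B) := by
  have h1 : μ σ τ B = ∑ z : X × Y, μ σ τ (B ∩ cyl [z]) := by
    rw [← tsum_fintype (L := .unconditional _), ← measure_iUnion]
    · congr 1
      ext w
      simp only [Set.mem_iUnion, Set.mem_inter_iff, mem_cyl]
      constructor
      · intro h; exact ⟨w 0, h, by simp [pre]⟩
      · rintro ⟨z, h, _⟩; exact h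
    · intro z z' hz
      refine Set.disjoint_left.2 ?_
      rintro w ⟨_, h⟩ ⟨_, h2⟩
      rw [mem_cyl] at h h2
      apply hz
      have := h.symm.trans h2
      simpa using this
    · exact fun z => hB.inter (meas_cyl _)
  rw [h1, Fintype.sum_prod_type_right]
  refine Finset.sum_congr rfl fun b _ => Finset.sum_congr rfl fun a _ => ?_
  rw [cond hμ σ τ _ hB, cylProb_cons, cylProb_nil, mul_one]

/-- first move lemma for the lower value -/
lemma L_ge (hμ : ∀ σ τ, IsInduced σ τ (μ σ τ)) {B : Set (Play (X × Y))} (hB : MeasurableSet B)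
    (x : PMF X) (c : ENNReal) (h : ∀ b, c ≤ ∑ a, x a * L μ (app [(a, b)] ⁻¹' B)) :
    c ≤ L μ B := by
  refine ENNReal.le_of_forall_pos_le_add fun ε hε _ => ?_
  have hex : ∀ z : X × Y, ∃ s, ∀ t, L μ (app [z] ⁻¹' B) ≤ μ s t (app [z] ⁻¹' B) + ε := by
    intro z
    obtain ⟨s, hs⟩ := approx_iSup (le_refl (L μ (app [z] ⁻¹' B)))
      (ne_top_of_le_ne_top ENNReal.one_ne_top (L_le_one hμ _))
      (show (ε : ENNReal) ≠ 0 by simp [hε.ne'])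
    exact ⟨s, fun t => hs.trans (by gcongr; exact iInf_le _ t)⟩
  choose s hs using hex
  let σ : Strategy (X × Y) X := fun q => match q with
    | [] => x
    | z :: r => s z r
  refine le_trans (b := (⨅ τ, μ σ τ B) + ε) ?_ (by
    gcongr; exact le_iSup (fun σ => ⨅ τ, μ σ τ B) σ)
  rw [ENNReal.iInf_add]
  refine le_iInf fun τ => ?_
  have e : ∀ z, sh σ [z] = s z := fun z => rfl
  calc c = ∑ b, τ [] b * c := by rw [← Finset.sum_mul, pmf_sum, one_mul]
    _ ≤ ∑ b, τ [] b * ∑ a, x a * L μ (app [(a, b)] ⁻¹' B) := by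
        gcongr with b; exact h b
    _ ≤ ∑ b, τ [] b * ∑ a, x a * (μ (s (a, b)) (sh τ [(a, b)]) (app [(a, b)] ⁻¹' B) + ε) := by
        gcongr with b _ a; exact hs _ _
    _ = ∑ b, (τ [] b * ∑ a, x a * μ (s (a, b)) (sh τ [(a, b)]) (app [(a, b)] ⁻¹' B)
          + τ [] b * ε) := by
        refine Finset.sum_congr rfl fun b _ => ?_
        simp_rw [mul_add (x _)]
        rw [Finset.sum_add_distrib, ← Finset.sum_mul, pmf_sum, one_mul, mul_add]
    _ = μ σ τ B + ε := by
        rw [Finset.sum_add_distrib, ← Finset.sum_mul, pmf_sum, one_mul, one_step hμ σ τ hB]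
        congr 1
        refine Finset.sum_congr rfl fun b _ => ?_
        rw [Finset.mul_sum]
        refine Finset.sum_congr rfl fun a _ => ?_
        rw [e, ← mul_assoc, mul_comm (τ [] b)]

lemma open_game (hμ : ∀ σ τ, IsInduced σ τ (μ σ τ)) {T : ℕ → Set (Play (X × Y))}
    (hT : ∀ n, IsOpen (T n)) (hmono : Monotone T) :
    ∃ τ, ∀ σ, μ σ τ (⋃ n, T n) ≤ ⨆ n, L μ (T n) := by
  set v : List (X × Y) → ENNReal := fun p => ⨆ n, L μ (app p ⁻¹' T n) with hv
  have hLm : ∀ p, Monotone fun n => L μ (app p ⁻¹' T n) := fun p n m hnm =>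
    L_mono (Set.preimage_mono (hmono hnm))
  have hex : ∀ p, ∃ y : PMF Y, ∀ a, ∑ b, y b * v (p ++ [(a, b)]) ≤ v p := by
    intro p
    refine (minimax_alt (fun a b => v (p ++ [(a, b)]))
      (fun a b => iSup_le fun n => L_le_one hμ _) (v p)).resolve_left ?_
    rintro ⟨x, hx⟩
    obtain ⟨b0, hb0⟩ := Finite.exists_min fun b => ∑ a, x a * v (p ++ [(a, b)])
    obtain ⟨c, hc1, hc2⟩ := exists_between (hx b0)
    have hn : ∀ b, ∃ n, c < ∑ a, x a * L μ (app (p ++ [(a, b)]) ⁻¹' T n) := by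
      intro b
      have h1 := hc2.trans_le (hb0 b)
      simp only [hv, ENNReal.mul_iSup] at h1
      rw [ENNReal.finsetSum_iSup_of_monotone] at h1
      · exact lt_iSup_iff.1 h1
      · intro a n m hnm
        dsimp only
        gcongr
        exact hLm _ hnm
    choose n hn using hn
    obtain ⟨N, hN⟩ : ∃ N, ∀ b, n b ≤ N := ⟨Finset.univ.sup n, fun b => Finset.le_sup (Finset.mem_univ b)⟩
    have h2 : c ≤ L μ (app p ⁻¹' T N) := by
      refine L_ge hμ (meas_app p (hT N).measurableSet) x c fun b => (hn b).le.trans ?_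
      gcongr with a
      have e2 : app (p ++ [(a, b)]) ⁻¹' T (n b) = app [(a, b)] ⁻¹' (app p ⁻¹' T (n b)) := by
        ext w; simp [app_append]
      rw [e2]
      exact L_mono (Set.preimage_mono (Set.preimage_mono (hmono (hN b))))
    exact absurd (h2.trans (le_iSup (fun n => L μ (app p ⁻¹' T n)) N)) (not_le.2 hc1)
  choose τ hτ using hex
  refine ⟨τ, fun σ => ?_⟩
  set E : ℕ → List (X × Y) → Set (Play (X × Y)) := fun m p =>
    {w | ∃ n, cyl (p ++ pre w m) ⊆ T n} with hE
  have hEo : ∀ m p, MeasurableSet (E m p) := by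
    intro m p
    have : E m p = ⋃ q : {q : List (X × Y) // q.length = m ∧ ∃ n, cyl (p ++ q) ⊆ T n}, cyl q.1 := by
      ext w
      simp only [Set.mem_iUnion]
      constructor
      · intro h; exact ⟨⟨pre w m, by simp, h⟩, mem_cyl_pre _ _⟩
      · rintro ⟨⟨q, hq, h⟩, hw⟩
        rw [mem_cyl] at hw
        dsimp only at hw
        rw [hq] at hw
        change ∃ n, cyl (p ++ pre w m) ⊆ T n
        rw [hw]; exact h
    rw [this]
    exact MeasurableSet.iUnion fun q => meas_cyl _
  have key : ∀ m p s, μ s (sh τ p) (E m p) ≤ v p := by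
    intro m
    induction m with
    | zero =>
      intro p s
      by_cases h : ∃ n, cyl p ⊆ T n
      · obtain ⟨n, hn⟩ := h
        have e : app p ⁻¹' T n = Set.univ := by
          ext w; simp [hn (app_mem_cyl p w)]
        have := (hμ s (sh τ p)).1
        refine prob_le_one.trans ?_
        refine le_trans ?_ (le_iSup (fun n => L μ (app p ⁻¹' T n)) n)
        rw [e, L]
        refine le_iSup_of_le (Classical.arbitrary _) (le_iInf fun t => ?_)
        have := (hμ (Classical.arbitrary _) t).1
        rw [measure_univ]
      · have : E 0 p = ∅ := by
          ext w
          simp only [Set.mem_empty_iff_false, iff_false]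
          intro hw
          apply h
          have hw' : ∃ n, cyl (p ++ pre w 0) ⊆ T n := hw
          simpa [pre] using hw'
        rw [this]; simp
    | succ m ih =>
      intro p s
      rw [one_step hμ _ _ (hEo _ _)]
      have e : ∀ z, app [z] ⁻¹' E (m + 1) p = E m (p ++ [z]) := by
        intro z
        ext w
        change (∃ n, cyl (p ++ pre (app [z] w) (m + 1)) ⊆ T n) ↔
          ∃ n, cyl ((p ++ [z]) ++ pre w m) ⊆ T n
        have := pre_app_add [z] w m
        rw [List.length_singleton, add_comm] at this
        rw [this, List.append_assoc]
      calc _ ≤ ∑ b, ∑ a, s [] a * τ p b * v (p ++ [(a, b)]) := by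
            gcongr with b _ a
            · simp [sh]
            · rw [e, ← sh_append]; exact ih _ _
        _ = ∑ a, s [] a * ∑ b, τ p b * v (p ++ [(a, b)]) := by
            rw [Finset.sum_comm]
            refine Finset.sum_congr rfl fun a _ => ?_
            rw [Finset.mul_sum]
            refine Finset.sum_congr rfl fun b _ => ?_
            rw [mul_assoc]
        _ ≤ ∑ a, s [] a * v p := by gcongr with a; exact hτ p a
        _ = v p := by rw [← Finset.sum_mul, pmf_sum, one_mul]
  have hUE : (⋃ n, T n) = ⋃ m, E m [] := by
    ext w
    simp only [Set.mem_iUnion]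
    constructor
    · rintro ⟨n, hn⟩
      obtain ⟨m, hm⟩ := exists_cyl_subset (hT n) hn
      exact ⟨m, n, hm⟩
    · rintro ⟨m, n, hm⟩
      exact ⟨n, hm (mem_cyl_pre w m)⟩
  have hEm : Monotone fun m => E m [] := by
    intro m m' hmm w
    rintro ⟨n, hn⟩
    exact ⟨n, (cyl_anti (pre_prefix w hmm)).trans hn⟩
  rw [hUE, hEm.measure_iUnion]
  refine iSup_le fun m => ?_
  have := key m [] σ
  rw [sh_nil] at this
  refine this.trans (le_of_eq ?_)
  simp only [hv]
  congr 1

lemma main (hμ : ∀ σ τ, IsInduced σ τ (μ σ τ)) {D : ℕ → Set (Play (X × Y))}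
    (hD : ∀ i, IsGδ (D i)) : ⨅ τ, ⨆ σ, μ σ τ (⋃ i, D i) ≤ L μ (⋃ i, D i) := by
  refine ENNReal.le_of_forall_pos_le_add fun ε hε _ => ?_
  obtain ⟨δ, hδ0, hδ⟩ := ENNReal.exists_pos_sum_of_countable'
    (ε := (ε : ENNReal)) (by simp [hε.ne']) ℕ
  have hrest : ∀ n, MeasurableSet (⋃ i, D (n + i)) := fun n =>
    MeasurableSet.iUnion fun i => (hD _).measurableSet
  have hex : ∀ (n : ℕ) (T : {T : Set (Play (X × Y)) // IsOpen T}), ∃ O, IsOpen O ∧ D n ⊆ O ∧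
      L μ ((T.1 ∪ ⋃ i, D (n + 1 + i)) ∪ O) ≤ L μ ((T.1 ∪ ⋃ i, D (n + 1 + i)) ∪ D n) + δ n :=
    fun n T => stepR hμ (T.2.measurableSet.union (hrest _)) (hD n) (hδ0 n).ne'
  choose O hOo hDO hOL using hex
  let T : ℕ → {T : Set (Play (X × Y)) // IsOpen T} := fun n =>
    Nat.rec ⟨∅, isOpen_empty⟩ (fun n T => ⟨T.1 ∪ O n T, T.2.union (hOo n T)⟩) n
  have hTs : ∀ n, (T (n + 1)).1 = (T n).1 ∪ O n (T n) := fun n => rfl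
  have hmono : Monotone fun n => (T n).1 := monotone_nat_of_le_succ fun n => by
    rw [hTs]; exact Set.subset_union_left
  have hL : ∀ n, L μ ((T n).1 ∪ ⋃ i, D (n + i)) ≤
      L μ (⋃ i, D i) + ∑ k ∈ Finset.range n, δ k := by
    intro n
    induction n with
    | zero =>
      have : (T 0).1 = ∅ := rfl
      simp [this]
    | succ n ih =>
      rw [Finset.sum_range_succ, ← add_assoc]
      refine le_trans ?_ (add_le_add_left ih (δ n))
      refine le_trans (L_mono ?_) ((hOL n (T n)).trans (add_le_add_left (L_mono ?_) _))
      · rw [hTs]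
        intro w hw
        simp only [Set.mem_union] at *
        tauto
      · intro w hw
        rcases hw with (hw | hw) | hw
        · exact Or.inl hw
        · obtain ⟨i, hi⟩ := Set.mem_iUnion.1 hw
          refine Or.inr (Set.mem_iUnion.2 ⟨1 + i, ?_⟩)
          rw [← add_assoc]; exact hi
        · exact Or.inr (Set.mem_iUnion.2 ⟨0, hw⟩)
  obtain ⟨τ, hτ⟩ := open_game hμ (fun n => (T n).2) hmono
  refine iInf_le_of_le τ (iSup_le fun σ => ?_)
  refine le_trans (measure_mono ?_) ((hτ σ).trans (iSup_le fun n => ?_))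
  · refine Set.iUnion_subset fun i w hw => Set.mem_iUnion.2 ⟨i + 1, ?_⟩
    exact Or.inr (hDO i (T i) hw)
  · refine (L_mono Set.subset_union_left).trans ((hL n).trans ?_)
    gcongr
    exact (ENNReal.sum_le_tsum _).trans hδ.le

end prob

/-- the induced measures force the sigma-algebra of the first factor to separate points -/
lemma sep_left {X Y : Type} [Fintype X] [Nonempty Y] [MeasurableSpace X] [MeasurableSpace Y]
    (μ : Strategy (X × Y) X → Strategy (X × Y) Y → Measure (Play (X × Y)))
    (hμ : ∀ σ τ, IsInduced σ τ (μ σ τ)) : MeasurableSingletonClass X := by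
  classical
  obtain ⟨y⟩ := ‹Nonempty Y›
  have hsep : ∀ x x' : X, x ≠ x' → ∃ A : Set X, MeasurableSet A ∧ x ∈ A ∧ x' ∉ A := by
    intro x x' hne
    by_contra! hcon
    let σ : Strategy (X × Y) X := fun _ => PMF.pure x'
    let τ : Strategy (X × Y) Y := fun _ => PMF.pure y
    have h0 : μ σ τ (cyl [(x, y)]) = 0 := by
      rw [(hμ σ τ).2, cylProb_cons]
      simp [σ, PMF.pure_apply, hne]
    have h1 : μ σ τ (cyl [(x', y)]) = 1 := by
      rw [(hμ σ τ).2, cylProb_cons, cylProb_nil]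
      simp [σ, τ, PMF.pure_apply]
    have hsub : cyl [(x', y)] ⊆ toMeasurable (μ σ τ) (cyl [(x, y)]) := by
      intro w hw
      have hw0 : w 0 = (x', y) := hw ⟨0, by simp⟩
      let φ : X → Play (X × Y) := fun u => Function.update w 0 (u, y)
      have hφ : Measurable φ := (measurable_update w).comp measurable_prodMk_right
      have hm := hφ (measurableSet_toMeasurable (μ σ τ) (cyl [(x, y)]))
      have hx : x ∈ φ ⁻¹' toMeasurable (μ σ τ) (cyl [(x, y)]) := by
        refine subset_toMeasurable _ _ ?_
        rw [mem_cyl]; simp [pre, φ]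
      have := hcon _ hm hx
      rw [Set.mem_preimage] at this
      have e : φ x' = w := by simp only [φ]; rw [← hw0]; exact Function.update_eq_self _ _
      rwa [e] at this
    have := measure_mono (μ := μ σ τ) hsub
    rw [measure_toMeasurable, h0, h1] at this
    simp at this
  refine ⟨fun x => ?_⟩
  choose! A hA1 hA2 hA3 using fun x' (h : x ≠ x') => hsep x x' h
  have : ({x} : Set X) = ⋂ x' : {x' // x ≠ x'}, A x'.1 := by
    ext u
    simp only [Set.mem_singleton_iff, Set.mem_iInter]
    constructor
    · rintro rfl x'; exact hA2 _ x'.2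
    · intro h
      by_contra hu
      exact hA3 u (Ne.symm hu) (h ⟨u, Ne.symm hu⟩)
  rw [this]
  exact MeasurableSet.iInter fun other => hA1 _ other.2

/-- the induced measures force the sigma-algebra of the second factor to separate points -/
lemma sep_right {X Y : Type} [Fintype Y] [Nonempty X] [MeasurableSpace X] [MeasurableSpace Y]
    (μ : Strategy (X × Y) X → Strategy (X × Y) Y → Measure (Play (X × Y)))
    (hμ : ∀ σ τ, IsInduced σ τ (μ σ τ)) : MeasurableSingletonClass Y := by
  classical
  obtain ⟨y⟩ := ‹Nonempty X›
  have hsep : ∀ x x' : Y, x ≠ x' → ∃ A : Set Y, MeasurableSet A ∧ x ∈ A ∧ x' ∉ A := by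
    intro x x' hne
    by_contra! hcon
    let σ : Strategy (X × Y) X := fun _ => PMF.pure y
    let τ : Strategy (X × Y) Y := fun _ => PMF.pure x'
    have h0 : μ σ τ (cyl [(y, x)]) = 0 := by
      rw [(hμ σ τ).2, cylProb_cons]
      simp [σ, τ, PMF.pure_apply, hne]
    have h1 : μ σ τ (cyl [(y, x')]) = 1 := by
      rw [(hμ σ τ).2, cylProb_cons, cylProb_nil]
      simp [σ, τ, PMF.pure_apply]
    have hsub : cyl [(y, x')] ⊆ toMeasurable (μ σ τ) (cyl [(y, x)]) := by
      intro w hw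
      have hw0 : w 0 = (y, x') := hw ⟨0, by simp⟩
      let φ : Y → Play (X × Y) := fun u => Function.update w 0 (y, u)
      have hφ : Measurable φ := (measurable_update w).comp measurable_prodMk_left
      have hm := hφ (measurableSet_toMeasurable (μ σ τ) (cyl [(y, x)]))
      have hx : x ∈ φ ⁻¹' toMeasurable (μ σ τ) (cyl [(y, x)]) := by
        refine subset_toMeasurable _ _ ?_
        rw [mem_cyl]; simp [pre, φ]
      have := hcon _ hm hx
      rw [Set.mem_preimage] at this
      have e : φ x' = w := by simp only [φ]; rw [← hw0]; exact Function.update_eq_self _ _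
      rwa [e] at this
    have := measure_mono (μ := μ σ τ) hsub
    rw [measure_toMeasurable, h0, h1] at this
    simp at this
  refine ⟨fun x => ?_⟩
  choose! A hA1 hA2 hA3 using fun x' (h : x ≠ x') => hsep x x' h
  have : ({x} : Set Y) = ⋂ x' : {x' // x ≠ x'}, A x'.1 := by
    ext u
    simp only [Set.mem_singleton_iff, Set.mem_iInter]
    constructor
    · rintro rfl x'; exact hA2 _ x'.2
    · intro h
      by_contra hu
      exact hA3 u (Ne.symm hu) (h ⟨u, Ne.symm hu⟩)
  rw [this]
  exact MeasurableSet.iInter fun other => hA1 _ other.2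

end BW

/-- Blackwell games on Gδσ sets (countable unions of Gδ sets) are determined. -/
theorem stmt_19 {X Y : Type} [Fintype X] [Nonempty X] [Fintype Y] [Nonempty Y]
    [MeasurableSpace X] [MeasurableSpace Y]
    [TopologicalSpace X] [DiscreteTopology X]
    [TopologicalSpace Y] [DiscreteTopology Y]
    (μ : Strategy (X × Y) X → Strategy (X × Y) Y → Measure (Play (X × Y)))
    (hμ : ∀ σ τ, IsInduced σ τ (μ σ τ))
    (D : ℕ → Set (Play (X × Y))) (hD : ∀ i, IsGδ (D i)) :
    (⨆ σ, ⨅ τ, (μ σ τ (⋃ i, D i)).toReal) =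
      ⨅ τ, ⨆ σ, (μ σ τ (⋃ i, D i)).toReal := by
  have := BW.sep_left μ hμ
  have := BW.sep_right μ hμ
  have hfin : ∀ σ τ, μ σ τ (⋃ i, D i) ≠ ⊤ := fun σ τ => by
    have := (hμ σ τ).1
    exact measure_ne_top _ _
  have hle : ∀ σ τ, μ σ τ (⋃ i, D i) ≤ 1 := fun σ τ => by
    have := (hμ σ τ).1
    exact prob_le_one
  have hinf : ∀ σ, ⨅ τ, μ σ τ (⋃ i, D i) ≠ ⊤ := fun σ =>
    ne_top_of_le_ne_top ENNReal.one_ne_top (iInf_le_of_le (Classical.arbitrary _) (hle σ _))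
  have hsup : ∀ τ, ⨆ σ, μ σ τ (⋃ i, D i) ≠ ⊤ := fun τ =>
    ne_top_of_le_ne_top ENNReal.one_ne_top (iSup_le fun σ => hle σ τ)
  have e1 : (⨆ σ, ⨅ τ, (μ σ τ (⋃ i, D i)).toReal) = (⨆ σ, ⨅ τ, μ σ τ (⋃ i, D i)).toReal := by
    rw [ENNReal.toReal_iSup hinf]
    congr 1
    funext σ
    rw [ENNReal.toReal_iInf (hfin σ)]
  have e2 : (⨅ τ, ⨆ σ, (μ σ τ (⋃ i, D i)).toReal) = (⨅ τ, ⨆ σ, μ σ τ (⋃ i, D i)).toReal := by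
    rw [ENNReal.toReal_iInf hsup]
    congr 1
    funext τ
    rw [ENNReal.toReal_iSup fun σ => hfin σ τ]
  rw [e1, e2]
  congr 1
  exact le_antisymm (iSup_iInf_le_iInf_iSup _) (BW.main hμ hD)
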